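/- arXiv:1607.00702 — 2 statements merged into one kernel-verified Lean document; each statement's English description precedes it below -/
import Mathlib

section
/- Suppose 𝒫 is regular-sparse with respect to A and let (ψ_1,...,ψ_K) be an arbitrary set of intrinsic sparse modes of A. Fix m and let Ψ_m ∈ ℝ^{|P_m|×K_m} be the matrix of nonzero restrictions of the ψ_k to P_m, and let D_m^{(ψ)} be the matrix with Ψ_m = H_m D_m^{(ψ)}. Then D_m^{(ψ)} is an orthogonal K_m×K_m matrix and it jointly diagonalizes the matrices Σ_{n;m} = Λ_mn Λ_mnᵀ for n = 1,...,M: for every n, (D_m^{(ψ)})ᵀ Σ_{n;m} D_m^{(ψ)} = (L_m L_nᵀ)(L_m L_nᵀ)ᵀ, which is a diagonal matrix with diagonal entries equal to 0 or 1. -/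
open Matrix BigOperators

/-- Restriction of a vector `ψ ∈ ℝ^N` to the indices in a patch `Pm`. -/
def restrictPatch {N : ℕ} (Pm : Finset (Fin N)) (ψ : Fin N → ℝ) : ↥Pm → ℝ :=
  fun i => ψ i

/-- Patch-wise sparseness `s(ψ;𝒫)`: the number of patches on which `ψ` is nonzero. -/
noncomputable def sparseness {N M : ℕ} (P : Fin M → Finset (Fin N)) (ψ : Fin N → ℝ) : ℕ :=
  {m : Fin M | restrictPatch (P m) ψ ≠ 0}.ncard

/-- `P` is a partition of `{1,...,N}` into disjoint nonempty patches. -/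
def IsPartition {N M : ℕ} (P : Fin M → Finset (Fin N)) : Prop :=
  (∀ m, (P m).Nonempty) ∧ (∀ m m', m ≠ m' → Disjoint (P m) (P m')) ∧ (∀ i, ∃ m, i ∈ P m)

/-- `K_m`: the rank of the principal submatrix `A_mm`. -/
noncomputable def patchRank {N : ℕ} (A : Matrix (Fin N) (Fin N) ℝ) (Pm : Finset (Fin N)) : ℕ :=
  (A.submatrix (fun i : ↥Pm => (i : Fin N)) (fun i : ↥Pm => (i : Fin N))).rank

/-- The partition `P` is regular-sparse w.r.t. `A`. -/
def RegularSparse {N M : ℕ} (K : ℕ) (A : Matrix (Fin N) (Fin N) ℝ)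
    (P : Fin M → Finset (Fin N)) : Prop :=
  ∃ g : Fin K → Fin N → ℝ,
    A = ∑ k, vecMulVec (g k) (g k) ∧
    ∀ m, LinearIndependent ℝ
      (fun k : {k : Fin K // restrictPatch (P m) (g k) ≠ 0} =>
        restrictPatch (P m) (g (k : Fin K)))

/-- `(ψ_1,...,ψ_K)` is a set of intrinsic sparse modes of `A` w.r.t. the partition `P`. -/
def IsISM {N M K : ℕ} (A : Matrix (Fin N) (Fin N) ℝ) (P : Fin M → Finset (Fin N))
    (ψ : Fin K → Fin N → ℝ) : Prop :=
  A = ∑ k, vecMulVec (ψ k) (ψ k) ∧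
  ∀ φ : Fin K → Fin N → ℝ, A = ∑ k, vecMulVec (φ k) (φ k) →
    ∑ k, sparseness P (ψ k) ≤ ∑ k, sparseness P (φ k)

/-- Two modes are unidentifiable on partition `P`: supported on exactly the same patches. -/
def Unidentifiable {N M : ℕ} (P : Fin M → Finset (Fin N)) (g g' : Fin N → ℝ) : Prop :=
  ∀ m, restrictPatch (P m) g ≠ 0 ↔ restrictPatch (P m) g' ≠ 0

/-- The block diagonal matrix `H_ext = diag(H_1, ..., H_M)`. -/
def Hext {N M : ℕ} (P : Fin M → Finset (Fin N)) (Km : Fin M → ℕ)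
    (H : ∀ m, Matrix ↥(P m) (Fin (Km m)) ℝ) :
    Matrix (Fin N) ((m : Fin M) × Fin (Km m)) ℝ :=
  Matrix.of fun i c => if h : i ∈ P c.1 then H c.1 ⟨i, h⟩ c.2 else 0

/-- The `(m,n)` block `Λ_mn` of a matrix indexed by `Σ m, Fin (Km m)`. -/
def ΛBlock {M : ℕ} {Km : Fin M → ℕ}
    (Λ : Matrix ((m : Fin M) × Fin (Km m)) ((m : Fin M) × Fin (Km m)) ℝ) (m n : Fin M) :
    Matrix (Fin (Km m)) (Fin (Km n)) ℝ :=
  Matrix.of fun i j => Λ ⟨m, i⟩ ⟨n, j⟩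

/-- Joint diagonalization objective: sum of squares of off-diagonal entries of `Vᵀ S_n V`. -/
noncomputable def offDiagObj {n M : ℕ} (S : Fin M → Matrix (Fin n) (Fin n) ℝ)
    (V : Matrix (Fin n) (Fin n) ℝ) : ℝ :=
  ∑ p, ∑ i, ∑ j, if i ≠ j then ((Vᵀ * S p * V) i j) ^ 2 else 0

/-- A real matrix with linearly independent columns has a left inverse. -/
theorem exists_mul_eq_one_of_linearIndependent_col {m n : Type*} [Fintype m] [Fintype n]
    [DecidableEq m] [DecidableEq n] (H : Matrix m n ℝ)
    (hH : LinearIndependent ℝ (fun j : n => fun i : m => H i j)) :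
    ∃ X : Matrix n m ℝ, X * H = 1 := by
  have hker : LinearMap.ker (Matrix.toLin' H) = ⊥ :=
    LinearMap.ker_eq_bot.2 (Matrix.mulVec_injective_iff.2 hH)
  obtain ⟨g, hg⟩ := LinearMap.exists_leftInverse_of_injective _ hker
  refine ⟨LinearMap.toMatrix' g, ?_⟩
  rw [← LinearMap.toMatrix'_toLin' H, ← LinearMap.toMatrix'_comp, hg, LinearMap.toMatrix'_id]

/-- The span of a family equals the span of its nonzero members. -/
theorem span_range_subtype_ne_zero {ι V : Type*} [AddCommGroup V] [Module ℝ V] (v : ι → V) :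
    Submodule.span ℝ (Set.range fun k : {k // v k ≠ 0} => v k) =
      Submodule.span ℝ (Set.range v) := by
  apply le_antisymm
  · exact Submodule.span_mono (by rintro _ ⟨k, rfl⟩; exact ⟨k, rfl⟩)
  · rw [Submodule.span_le]
    rintro _ ⟨k, rfl⟩
    by_cases hk : v k = 0
    · simp [hk]
    · exact Submodule.subset_span ⟨⟨k, hk⟩, rfl⟩

/-- The matrix whose columns are the restrictions of a family of vectors to a patch. -/
def patchMatrix {N K : ℕ} (Pm : Finset (Fin N)) (φ : Fin K → Fin N → ℝ) :
    Matrix ↥Pm (Fin K) ℝ :=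
  Matrix.of fun i k => φ k i

theorem submatrix_eq_patchMatrix_mul_transpose {N K : ℕ} (φ : Fin K → Fin N → ℝ)
    (S T : Finset (Fin N)) :
    (∑ k, vecMulVec (φ k) (φ k)).submatrix (fun i : ↥S => (i : Fin N))
      (fun i : ↥T => (i : Fin N)) = patchMatrix S φ * (patchMatrix T φ)ᵀ := by
  ext i j
  simp [Matrix.sum_apply, Matrix.mul_apply, patchMatrix, vecMulVec_apply]

theorem patchRank_eq_finrank_span {N K : ℕ} (φ : Fin K → Fin N → ℝ) (S : Finset (Fin N)) :
    patchRank (∑ k, vecMulVec (φ k) (φ k)) S = Module.finrank ℝ (Submodule.span ℝ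
      (Set.range fun k : {k // restrictPatch S (φ k) ≠ 0} => restrictPatch S (φ k))) := by
  rw [patchRank, submatrix_eq_patchMatrix_mul_transpose, Matrix.rank_self_mul_transpose,
    Matrix.rank_eq_finrank_span_cols,
    span_range_subtype_ne_zero (fun k => restrictPatch S (φ k))]
  rfl

open Classical in
theorem patchRank_le_card {N K : ℕ} (φ : Fin K → Fin N → ℝ) (S : Finset (Fin N)) :
    patchRank (∑ k, vecMulVec (φ k) (φ k)) S ≤
      Fintype.card {k // restrictPatch S (φ k) ≠ 0} := by
  rw [patchRank_eq_finrank_span]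
  exact finrank_range_le_card _

open Classical in
theorem patchRank_eq_card {N K : ℕ} (φ : Fin K → Fin N → ℝ) (S : Finset (Fin N))
    (h : LinearIndependent ℝ
      (fun k : {k // restrictPatch S (φ k) ≠ 0} => restrictPatch S (φ (k : Fin K)))) :
    patchRank (∑ k, vecMulVec (φ k) (φ k)) S =
      Fintype.card {k // restrictPatch S (φ k) ≠ 0} := by
  rw [patchRank_eq_finrank_span]
  exact finrank_span_eq_card h

open Classical in
/-- Double counting: total sparseness is the sum over patches of the local dimensions. -/
theorem sum_sparseness {N M K : ℕ} (P : Fin M → Finset (Fin N)) (φ : Fin K → Fin N → ℝ) :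
    ∑ k, sparseness P (φ k) =
      ∑ m, Fintype.card {k // restrictPatch (P m) (φ k) ≠ 0} := by
  have h : ∀ k, sparseness P (φ k) =
      ∑ m, if restrictPatch (P m) (φ k) ≠ 0 then 1 else 0 := fun k => by
    rw [sparseness, Set.ncard_eq_toFinset_card', Finset.sum_boole]
    simp
  simp_rw [h, Fintype.card_subtype]
  rw [Finset.sum_comm]
  exact Finset.sum_congr rfl fun m _ => by rw [Finset.sum_boole, Nat.cast_id]

open Classical in
/-- For a regular-sparse partition, the number of intrinsic sparse modes that are nonzero on a
patch is the local rank. -/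
theorem IsISM.card_eq_patchRank {N M K : ℕ} {A : Matrix (Fin N) (Fin N) ℝ}
    {P : Fin M → Finset (Fin N)} {ψ : Fin K → Fin N → ℝ} (hism : IsISM A P ψ)
    (hreg : RegularSparse K A P) (n : Fin M) :
    Fintype.card {k // restrictPatch (P n) (ψ k) ≠ 0} = patchRank A (P n) := by
  obtain ⟨g, hg, hli⟩ := hreg
  have hle : ∀ m ∈ Finset.univ,
      patchRank A (P m) ≤ Fintype.card {k // restrictPatch (P m) (ψ k) ≠ 0} := fun m _ => by
    rw [hism.1]
    exact patchRank_le_card ψ (P m)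
  have hsum : ∑ m, Fintype.card {k // restrictPatch (P m) (ψ k) ≠ 0} ≤
      ∑ m, patchRank A (P m) := by
    rw [← sum_sparseness]
    refine (hism.2 g hg).trans ?_
    rw [sum_sparseness]
    refine Finset.sum_le_sum fun m _ => ?_
    rw [hg]
    exact (patchRank_eq_card g (P m) (hli m)).ge
  exact ((Finset.sum_eq_sum_iff_of_le hle).1 ((Finset.sum_le_sum hle).antisymm hsum) n
    (Finset.mem_univ n)).symm

/-- On the patches of a partition, the blocks of `Hext * Λ * Hextᵀ` are `H_m Λ_mn H_nᵀ`. -/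
theorem submatrix_Hext_mul {N M : ℕ} {P : Fin M → Finset (Fin N)} (hP : IsPartition P)
    {Km : Fin M → ℕ} (H : ∀ m, Matrix ↥(P m) (Fin (Km m)) ℝ)
    (Λ : Matrix ((m : Fin M) × Fin (Km m)) ((m : Fin M) × Fin (Km m)) ℝ) (m n : Fin M) :
    (Hext P Km H * Λ * (Hext P Km H)ᵀ).submatrix (fun i : ↥(P m) => (i : Fin N))
      (fun i : ↥(P n) => (i : Fin N)) = H m * ΛBlock Λ m n * (H n)ᵀ := by
  have key : ∀ (p : Fin M) (i : ↥(P p)) (f : ((q : Fin M) × Fin (Km q)) → ℝ),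
      ∑ c, Hext P Km H i c * f c = ∑ a, H p i a * f ⟨p, a⟩ := fun p i f => by
    rw [Fintype.sum_sigma, Finset.sum_eq_single p]
    · simp [Hext]
    · intro q _ hqp
      have hi : (i : Fin N) ∉ P q := fun h =>
        Finset.disjoint_left.1 (hP.2.1 q p hqp) h i.2
      simp [Hext, hi]
    · simp
  ext i j
  rw [Matrix.submatrix_apply, Matrix.mul_assoc, Matrix.mul_assoc, Matrix.mul_apply, key,
    Matrix.mul_apply]
  refine Finset.sum_congr rfl fun a _ => ?_
  congr 1
  simp only [Matrix.mul_apply, Matrix.transpose_apply]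
  simp_rw [mul_comm (Λ _ _), mul_comm (ΛBlock Λ m n _ _)]
  rw [key]
  rfl

/-- The Gram-type matrix of two injections is diagonal with entries `0` or `1`. -/
theorem indicator_gram_apply {p q K : ℕ} {u : Fin p → Fin K} {v : Fin q → Fin K}
    (hu : Function.Injective u) (hv : Function.Injective v)
    {L : Matrix (Fin p) (Fin K) ℝ} {L' : Matrix (Fin q) (Fin K) ℝ}
    (hL : ∀ i k, L i k = if u i = k then 1 else 0)
    (hL' : ∀ i k, L' i k = if v i = k then 1 else 0) :
    (∀ i j, i ≠ j → ((L * L'ᵀ) * (L * L'ᵀ)ᵀ) i j = 0) ∧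
      ∀ i, ((L * L'ᵀ) * (L * L'ᵀ)ᵀ) i i = 0 ∨ ((L * L'ᵀ) * (L * L'ᵀ)ᵀ) i i = 1 := by
  have hB : ∀ i a, (L * L'ᵀ) i a = if u i = v a then 1 else 0 := fun i a => by
    simp [Matrix.mul_apply, hL, hL', eq_comm]
  constructor
  · intro i j hij
    rw [Matrix.mul_apply]
    refine Finset.sum_eq_zero fun a _ => ?_
    rw [Matrix.transpose_apply, hB, hB]
    by_cases h1 : u i = v a
    · have h2 : u j ≠ v a := fun h2 => hij (hu (h1.trans h2.symm))
      simp [h2]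
    · simp [h1]
  · intro i
    simp only [Matrix.mul_apply (M := L * L'ᵀ), Matrix.transpose_apply (M := L * L'ᵀ), hB]
    by_cases h : ∃ a, u i = v a
    · obtain ⟨a, ha⟩ := h
      right
      simp [ha, hv.eq_iff]
    · push Not at h
      left
      simp [h]

/-- Lemma 3.2 of the paper. Suppose `𝒫` is regular-sparse w.r.t. `A` and
`(ψ_1,...,ψ_K)` is an arbitrary set of intrinsic sparse modes. Let `Ψ_m` be the matrix of
nonzero restrictions of the `ψ_k` to `P_m` and `D_m^{(ψ)}` the matrix with
`Ψ_m = H_m D_m^{(ψ)}`. Then `D_m^{(ψ)}` is an orthogonal `K_m × K_m` matrix jointly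
diagonalizing `Σ_{n;m} = Λ_mn Λ_mnᵀ`: for every `n`,
`(D_m^{(ψ)})ᵀ Σ_{n;m} D_m^{(ψ)} = (L_m L_nᵀ)(L_m L_nᵀ)ᵀ`, a diagonal matrix with diagonal
entries 0 or 1. -/
theorem ism_local_rotation_jointly_diagonalizes
    {N M K : ℕ} (A : Matrix (Fin N) (Fin N) ℝ)
    (hA : A.PosSemidef) (hrank : A.rank = K)
    (P : Fin M → Finset (Fin N)) (hP : IsPartition P)
    (hreg : RegularSparse K A P)
    (ψ : Fin K → Fin N → ℝ) (hism : IsISM A P ψ)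
    (Km : Fin M → ℕ) (hKm : ∀ m, Km m = patchRank A (P m))
    (H : ∀ m, Matrix ↥(P m) (Fin (Km m)) ℝ)
    (hHli : ∀ m, LinearIndependent ℝ (fun j : Fin (Km m) => fun i : ↥(P m) => H m i j))
    (hH : ∀ m, A.submatrix (fun i : ↥(P m) => (i : Fin N)) (fun i : ↥(P m) => (i : Fin N))
      = H m * (H m)ᵀ)
    (Λ : Matrix ((m : Fin M) × Fin (Km m)) ((m : Fin M) × Fin (Km m)) ℝ)
    (hΛ : A = Hext P Km H * Λ * (Hext P Km H)ᵀ)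
    (d : Fin M → ℕ)
    (e : ∀ n, Fin (d n) ≃ {k : Fin K // restrictPatch (P n) (ψ k) ≠ 0})
    (L : ∀ n, Matrix (Fin (d n)) (Fin K) ℝ)
    (hL : ∀ (n : Fin M) (i : Fin (d n)) (k : Fin K),
      L n i k = if ((e n i : Fin K) = k) then 1 else 0)
    (m : Fin M)
    (Ψm : Matrix ↥(P m) (Fin (d m)) ℝ)
    (hΨm : ∀ (i : ↥(P m)) (j : Fin (d m)), Ψm i j = ψ (e m j : Fin K) (i : Fin N))
    (Dψ : Matrix (Fin (Km m)) (Fin (d m)) ℝ)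
    (hDψ : Ψm = H m * Dψ) :
    d m = Km m ∧
    Dψ * Dψᵀ = 1 ∧ Dψᵀ * Dψ = 1 ∧
    ∀ n : Fin M,
      Dψᵀ * (ΛBlock Λ m n * (ΛBlock Λ m n)ᵀ) * Dψ = (L m * (L n)ᵀ) * ((L m) * (L n)ᵀ)ᵀ ∧
      (∀ i j, i ≠ j → ((L m * (L n)ᵀ) * ((L m) * (L n)ᵀ)ᵀ) i j = 0) ∧
      (∀ i, ((L m * (L n)ᵀ) * ((L m) * (L n)ᵀ)ᵀ) i i = 0 ∨
        ((L m * (L n)ᵀ) * ((L m) * (L n)ᵀ)ᵀ) i i = 1) := by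
  classical
  choose X hX using fun n => exists_mul_eq_one_of_linearIndependent_col (H n) (hHli n)
  have hd : ∀ n, d n = Km n := fun n => by
    rw [hKm, ← hism.card_eq_patchRank hreg n, ← Fintype.card_congr (e n), Fintype.card_fin]
  let Ψ : ∀ n, Matrix ↥(P n) (Fin (d n)) ℝ := fun n => Matrix.of fun i j => ψ (e n j) i
  have hR : ∀ n, patchMatrix (P n) ψ = Ψ n * L n := fun n => by
    ext i k
    simp only [patchMatrix, Ψ, Matrix.mul_apply, Matrix.of_apply, hL, mul_ite, mul_one, mul_zero]
    by_cases hk : restrictPatch (P n) (ψ k) = 0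
    · rw [Finset.sum_eq_zero]
      · exact congrFun hk i
      · intro j _
        rw [if_neg]
        rintro rfl
        exact (e n j).2 hk
    · rw [Finset.sum_eq_single ((e n).symm ⟨k, hk⟩)]
      · simp
      · intro j _ hj
        rw [if_neg]
        rintro rfl
        exact hj (by simp)
      · simp
  have hLL : ∀ n, L n * (L n)ᵀ = 1 := fun n => by
    ext i j
    simp [Matrix.mul_apply, hL, Matrix.one_apply, ← Subtype.ext_iff, eq_comm]
  let D : ∀ n, Matrix (Fin (Km n)) (Fin (d n)) ℝ := fun n => X n * Ψ n
  have hblock : ∀ n p, A.submatrix (fun i : ↥(P n) => (i : Fin N)) (fun i : ↥(P p) => (i : Fin N))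
      = Ψ n * (L n * (L p)ᵀ) * (Ψ p)ᵀ := fun n p => by
    rw [hism.1, submatrix_eq_patchMatrix_mul_transpose, hR, hR, Matrix.transpose_mul]
    simp only [Matrix.mul_assoc]
  have hXT : ∀ n, (H n)ᵀ * (X n)ᵀ = 1 := fun n => by
    rw [← Matrix.transpose_mul, hX, Matrix.transpose_one]
  have hDD : ∀ n, D n * (D n)ᵀ = 1 := fun n => by
    have h := (hblock n n).symm.trans (hH n)
    rw [hLL, Matrix.mul_one] at h
    calc D n * (D n)ᵀ = X n * (Ψ n * (Ψ n)ᵀ) * (X n)ᵀ := by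
          simp only [D, Matrix.transpose_mul, Matrix.mul_assoc]
      _ = (X n * H n) * ((H n)ᵀ * (X n)ᵀ) := by rw [h]; simp only [Matrix.mul_assoc]
      _ = 1 := by rw [hX, hXT, Matrix.mul_one]
  have hDD' : ∀ n, (D n)ᵀ * D n = 1 := fun n =>
    (Matrix.mul_eq_one_comm_of_card_eq _ _ _ (by simp [hd n])).1 (hDD n)
  have hΛD : ∀ n p, ΛBlock Λ n p = D n * (L n * (L p)ᵀ) * (D p)ᵀ := fun n p => by
    have h := hblock n p
    rw [hΛ, submatrix_Hext_mul hP] at h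
    calc ΛBlock Λ n p = (X n * H n) * ΛBlock Λ n p * ((H p)ᵀ * (X p)ᵀ) := by
          rw [hX, hXT, Matrix.mul_one, Matrix.one_mul]
      _ = X n * (H n * ΛBlock Λ n p * (H p)ᵀ) * (X p)ᵀ := by simp only [Matrix.mul_assoc]
      _ = D n * (L n * (L p)ᵀ) * (D p)ᵀ := by
          rw [h]
          simp only [D, Matrix.transpose_mul, Matrix.mul_assoc]
  have hDψ' : Dψ = D m := by
    have hΨ : Ψm = Ψ m := by
      ext i j
      exact hΨm i j
    simp only [D]
    rw [← hΨ, hDψ, ← Matrix.mul_assoc, hX, Matrix.one_mul]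
  rw [hDψ']
  refine ⟨hd m, hDD m, hDD' m, fun n => ⟨?_, ?_⟩⟩
  · rw [hΛD m n]
    generalize L m * (L n)ᵀ = B
    calc (D m)ᵀ * (D m * B * (D n)ᵀ * (D m * B * (D n)ᵀ)ᵀ) * D m
        = ((D m)ᵀ * D m) * B * ((D n)ᵀ * D n) * Bᵀ * ((D m)ᵀ * D m) := by
          simp only [Matrix.transpose_mul, Matrix.transpose_transpose, Matrix.mul_assoc]
      _ = B * Bᵀ := by simp only [hDD', Matrix.mul_one, Matrix.one_mul]
  · exact indicator_gram_apply (Subtype.val_injective.comp (e m).injective)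
      (Subtype.val_injective.comp (e n).injective) (hL m) (hL n)
end

section
/- Suppose 𝒫 is regular-sparse with respect to A, fix m, and let D_m ∈ O(K_m) be a global minimizer of the joint diagonalization objective V ↦ Σ_{n=1}^M Σ_{i≠j} |(Vᵀ Σ_{n;m} V)_{i,j}|² over orthogonal V ∈ O(K_m). Set G_m = H_m D_m. Then there exists a set of intrinsic sparse modes (φ_1,...,φ_K) of A such that the columns of G_m are exactly the nonzero restrictions φ_k|_{P_m} (counted with multiplicity, in some order), i.e. G_m equals, up to a permutation of its columns, the matrix of local pieces of (φ_1,...,φ_K) on P_m. -/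
open Matrix BigOperators

theorem exists_mul_eq_one_of_linearIndependent_cols {ι κ : Type*} [Fintype ι] [Fintype κ]
    [DecidableEq ι] [DecidableEq κ] (H : Matrix ι κ ℝ)
    (hH : LinearIndependent ℝ (fun j i => H i j)) :
    ∃ L : Matrix κ ι ℝ, L * H = 1 := by
  have hinj : Function.Injective H.mulVec := Matrix.mulVec_injective_iff.2 hH
  obtain ⟨g, hg⟩ := H.mulVecLin.exists_leftInverse_of_injective (LinearMap.ker_eq_bot.2 hinj)
  refine ⟨LinearMap.toMatrix' g, ?_⟩
  have h := congrArg LinearMap.toMatrix' hg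
  rw [LinearMap.toMatrix'_comp, LinearMap.toMatrix'_id] at h
  rwa [← Matrix.toLin'_apply', LinearMap.toMatrix'_toLin'] at h

/-- If `B * Bᵀ = H * Hᵀ` and `L` is a left inverse of `H`, then `B` factors through `H`. -/
theorem mul_leftInverse_mul_eq {ι κ τ : Type*} [Fintype ι] [Fintype κ] [Fintype τ]
    [DecidableEq ι] [DecidableEq κ] {H : Matrix ι κ ℝ} {L : Matrix κ ι ℝ} {B : Matrix ι τ ℝ}
    (hL : L * H = 1) (hB : B * Bᵀ = H * Hᵀ) : H * (L * B) = B := by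
  have hX : (H * (L * B) - B) * (H * (L * B) - B)ᵀ = 0 := by
    have h1 : H * (L * B) - B = (H * L - 1) * B := by
      rw [Matrix.sub_mul, Matrix.one_mul, Matrix.mul_assoc]
    have h2 : (H * L - 1) * H = 0 := by
      rw [Matrix.sub_mul, Matrix.one_mul, Matrix.mul_assoc, hL, Matrix.mul_one, sub_self]
    rw [h1, Matrix.transpose_mul, Matrix.mul_assoc, ← Matrix.mul_assoc B, hB,
      ← Matrix.mul_assoc, ← Matrix.mul_assoc, h2, Matrix.zero_mul, Matrix.zero_mul]
  rw [← Matrix.conjTranspose_eq_transpose_of_trivial] at hX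
  exact sub_eq_zero.1 (Matrix.self_mul_conjTranspose_eq_zero.1 hX)

theorem leftInverse_mul_mul_transpose_eq_one {ι κ τ : Type*} [Fintype ι] [Fintype κ] [Fintype τ]
    [DecidableEq κ] {H : Matrix ι κ ℝ} {L : Matrix κ ι ℝ} {B : Matrix ι τ ℝ}
    (hL : L * H = 1) (hB : B * Bᵀ = H * Hᵀ) : (L * B) * (L * B)ᵀ = 1 := by
  calc (L * B) * (L * B)ᵀ = L * (B * Bᵀ) * Lᵀ := by
        simp only [Matrix.transpose_mul, Matrix.mul_assoc]
    _ = (L * H) * (L * H)ᵀ := by rw [hB]; simp only [Matrix.transpose_mul, Matrix.mul_assoc]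
    _ = 1 := by rw [hL]; simp

/-- A matrix with orthonormal rows has at least as many nonzero columns as rows. -/
theorem card_le_card_of_mul_transpose_eq_one {κ τ : Type*} [Fintype κ] [Fintype τ]
    [DecidableEq κ] {D : Matrix κ τ ℝ} (hD : D * Dᵀ = 1) (s : Finset τ)
    (hs : ∀ k ∉ s, ∀ i, D i k = 0) : Fintype.card κ ≤ s.card := by
  have hQ : (Dᵀ * D) * (Dᵀ * D) = Dᵀ * D := by
    rw [Matrix.mul_assoc, ← Matrix.mul_assoc D, hD, Matrix.one_mul]
  have hle : ∀ k, (Dᵀ * D) k k ≤ 1 := by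
    intro k
    have h1 : (Dᵀ * D) k k = ∑ j, (Dᵀ * D) k j * (Dᵀ * D) k j := by
      conv_lhs => rw [← hQ, Matrix.mul_apply]
      refine Finset.sum_congr rfl fun j _ => ?_
      congr 1
      simp only [Matrix.mul_apply, Matrix.transpose_apply, mul_comm]
    have h2 : (Dᵀ * D) k k * (Dᵀ * D) k k ≤ (Dᵀ * D) k k := by
      conv_rhs => rw [h1]
      exact Finset.single_le_sum (f := fun j => (Dᵀ * D) k j * (Dᵀ * D) k j)
        (fun j _ => mul_self_nonneg _) (Finset.mem_univ k)
    nlinarith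
  have htr : ((Fintype.card κ : ℕ) : ℝ) = ∑ k, (Dᵀ * D) k k := by
    have h := Matrix.trace_mul_comm D Dᵀ
    rw [hD, Matrix.trace_one] at h
    exact h
  have hsum : ∑ k, (Dᵀ * D) k k = ∑ k ∈ s, (Dᵀ * D) k k := by
    refine (Finset.sum_subset (Finset.subset_univ s) fun k _ hk => ?_).symm
    simp [Matrix.mul_apply, hs k hk]
  have : ((Fintype.card κ : ℕ) : ℝ) ≤ s.card := by
    rw [htr, hsum]
    calc ∑ k ∈ s, (Dᵀ * D) k k ≤ ∑ k ∈ s, (1 : ℝ) := Finset.sum_le_sum fun k _ => hle k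
      _ = s.card := by simp
  exact_mod_cast this

/-- If the nonzero columns of `B = H * D` are linearly independent and `D` has orthonormal rows,
then `Dᵀ * D` is the coordinate projection onto the nonzero columns. -/
theorem transpose_mul_self_eq_diagonal {ι κ τ : Type*} [Fintype κ] [Fintype τ]
    [DecidableEq κ] [DecidableEq τ] {H : Matrix ι κ ℝ} {L : Matrix κ ι ℝ} [Fintype ι]
    {D : Matrix κ τ ℝ} {B : Matrix ι τ ℝ} (hHD : H * D = B) (hLB : L * B = D) (hD : D * Dᵀ = 1)
    (p : τ → Prop) [DecidablePred p] (hp : ∀ k, ¬ p k → ∀ i, B i k = 0)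
    (hli : LinearIndependent ℝ (fun (k : {k // p k}) i => B i k)) :
    Dᵀ * D = Matrix.diagonal fun k => if p k then 1 else 0 := by
  have hDp : ∀ k, ¬ p k → ∀ i, D i k = 0 := by
    intro k hk i
    rw [← hLB, Matrix.mul_apply]
    exact Finset.sum_eq_zero fun j _ => by rw [hp k hk j, mul_zero]
  set E : Matrix τ τ ℝ := Matrix.diagonal fun k => if p k then 1 else 0 with hE
  have hDE : D * E = D := by
    ext i k
    rw [hE, Matrix.mul_diagonal]
    split_ifs with h
    · simp
    · simp [hDp k h i]
  have hBX : B * (Dᵀ * D - E) = 0 := by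
    rw [← hHD, Matrix.mul_assoc, Matrix.mul_sub, ← Matrix.mul_assoc D, hD, Matrix.one_mul, hDE,
      sub_self, Matrix.mul_zero]
  refine sub_eq_zero.1 (Matrix.ext fun k l => ?_)
  by_cases hk : p k
  · have hcomb : ∑ k : {k // p k}, (Dᵀ * D - E) k l • (fun i => B i k) = 0 := by
      ext i
      have h := congrFun (congrFun hBX i) l
      rw [Matrix.mul_apply, ← Fintype.sum_subtype_add_sum_subtype p] at h
      have h0 : ∑ k : {k // ¬ p k}, B i k * (Dᵀ * D - E) k l = 0 :=
        Finset.sum_eq_zero fun k _ => by rw [hp k k.2 i, zero_mul]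
      rw [h0, add_zero] at h
      simpa [mul_comm, Finset.sum_apply] using h
    exact Fintype.linearIndependent_iff.1 hli _ hcomb ⟨k, hk⟩
  · simp [Matrix.mul_apply, hE, Matrix.diagonal_apply, hk, hDp k hk]

/-- An invertible matrix has a nonvanishing generalized diagonal. -/
theorem exists_perm_forall_ne_zero {κ : Type*} [Fintype κ] [DecidableEq κ] {W : Matrix κ κ ℝ}
    (hW : W.det ≠ 0) : ∃ σ : Equiv.Perm κ, ∀ j, W (σ j) j ≠ 0 := by
  rw [Matrix.det_apply] at hW
  obtain ⟨σ, -, hσ⟩ := Finset.exists_ne_zero_of_sum_ne_zero hW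
  refine ⟨σ, fun j hj => hσ ?_⟩
  have h : ∏ i, W (σ i) i = 0 := Finset.prod_eq_zero (Finset.mem_univ j) hj
  simp [h]

theorem sum_sparseness_eq {N M K : ℕ} (P : Fin M → Finset (Fin N)) (ψ : Fin K → Fin N → ℝ)
    [∀ n, DecidablePred fun k => restrictPatch (P n) (ψ k) ≠ 0] :
    ∑ k, sparseness P (ψ k) =
      ∑ n, (Finset.univ.filter fun k => restrictPatch (P n) (ψ k) ≠ 0).card := by
  classical
  have h : ∀ k, sparseness P (ψ k) = ∑ n, if restrictPatch (P n) (ψ k) ≠ 0 then 1 else 0 := by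
    intro k
    rw [sparseness, Set.ncard_eq_toFinset_card', ← Finset.card_filter]
    congr 1
    ext n
    simp
  simp_rw [h, Finset.card_filter]
  rw [Finset.sum_comm]

theorem apply_eq_zero_of_offDiagObj_le_zero {n M : ℕ} {S : Fin M → Matrix (Fin n) (Fin n) ℝ}
    {V : Matrix (Fin n) (Fin n) ℝ} (h : offDiagObj S V ≤ 0) (p : Fin M) {i j : Fin n}
    (hij : i ≠ j) : (Vᵀ * S p * V) i j = 0 := by
  have h0 : ∀ p i j, 0 ≤ if i ≠ j then ((Vᵀ * S p * V) i j) ^ 2 else 0 := by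
    intro p i j
    split_ifs <;> positivity
  have h1 : (if i ≠ j then ((Vᵀ * S p * V) i j) ^ 2 else 0) ≤ offDiagObj S V := by
    refine le_trans ?_ (Finset.single_le_sum (fun p _ => Finset.sum_nonneg fun i _ =>
      Finset.sum_nonneg fun j _ => h0 p i j) (Finset.mem_univ p))
    refine le_trans ?_ (Finset.single_le_sum (fun i _ =>
      Finset.sum_nonneg fun j _ => h0 p i j) (Finset.mem_univ i))
    exact Finset.single_le_sum (fun j _ => h0 p i j) (Finset.mem_univ j)
  rw [if_pos hij] at h1
  exact pow_eq_zero_iff two_ne_zero |>.1 (le_antisymm (h1.trans h) (sq_nonneg _))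

/-- The matrix whose columns are the local pieces of the modes `ψ` on the patch `Pm`. -/
def localPieces {N K : ℕ} (Pm : Finset (Fin N)) (ψ : Fin K → Fin N → ℝ) :
    Matrix ↥Pm (Fin K) ℝ :=
  Matrix.of fun i k => ψ k i

theorem submatrix_eq_localPieces_mul {N K : ℕ} {A : Matrix (Fin N) (Fin N) ℝ}
    {ψ : Fin K → Fin N → ℝ} (hψ : A = ∑ k, vecMulVec (ψ k) (ψ k)) (Q R : Finset (Fin N)) :
    A.submatrix (fun i : ↥Q => (i : Fin N)) (fun i : ↥R => (i : Fin N)) =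
      localPieces Q ψ * (localPieces R ψ)ᵀ := by
  ext i j
  simp [hψ, localPieces, Matrix.mul_apply, Matrix.sum_apply, Matrix.vecMulVec_apply]

theorem Hext_apply {N M : ℕ} {P : Fin M → Finset (Fin N)} (hP : IsPartition P) {Km : Fin M → ℕ}
    (H : ∀ m, Matrix ↥(P m) (Fin (Km m)) ℝ) {m n : Fin M} (i : ↥(P m)) (c : Fin (Km n)) :
    Hext P Km H i ⟨n, c⟩ = if h : n = m then H m i (h ▸ c) else 0 := by
  by_cases h : n = m
  · subst h
    simp [Hext]
  · have : (i : Fin N) ∉ P n := fun hi => Finset.disjoint_left.1 (hP.2.1 n m h) hi i.2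
    simp [Hext, h, this]

theorem submatrix_eq_mul_ΛBlock_mul {N M : ℕ} {A : Matrix (Fin N) (Fin N) ℝ}
    {P : Fin M → Finset (Fin N)} (hP : IsPartition P) {Km : Fin M → ℕ}
    {H : ∀ m, Matrix ↥(P m) (Fin (Km m)) ℝ}
    {Λ : Matrix ((m : Fin M) × Fin (Km m)) ((m : Fin M) × Fin (Km m)) ℝ}
    (hΛ : A = Hext P Km H * Λ * (Hext P Km H)ᵀ) (m n : Fin M) :
    A.submatrix (fun i : ↥(P m) => (i : Fin N)) (fun i : ↥(P n) => (i : Fin N)) =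
      H m * ΛBlock Λ m n * (H n)ᵀ := by
  ext i j
  have hr : ∀ (m : Fin M) (i : ↥(P m)) (f : ((m : Fin M) × Fin (Km m)) → ℝ),
      ∑ c, Hext P Km H i c * f c = ∑ c, H m i c * f ⟨m, c⟩ := by
    intro m i f
    rw [Fintype.sum_sigma, Finset.sum_eq_single m]
    · simp [Hext_apply hP]
    · intro n _ hn
      simp [Hext_apply hP, hn]
    · simp
  rw [Matrix.submatrix_apply, hΛ, Matrix.mul_apply, Matrix.mul_apply]
  simp_rw [Matrix.transpose_apply, mul_comm _ (Hext P Km H j _), mul_comm _ (H n j _)]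
  rw [hr]
  simp_rw [Matrix.mul_apply, hr, ΛBlock, Matrix.of_apply]

/-- Lemma 3.3 of the paper. Suppose `𝒫` is regular-sparse w.r.t. `A` and
`D_m ∈ O(K_m)` is a global minimizer of the joint diagonalization objective for the matrices
`Σ_{n;m} = Λ_mn Λ_mnᵀ`, `n = 1,...,M`. Set `G_m = H_m D_m`. Then there exists a set of
intrinsic sparse modes `(φ_1,...,φ_K)` of `A` such that the columns of `G_m` are exactly the
nonzero restrictions `φ_k|_{P_m}` (up to a permutation of columns, encoded by the
bijection `eφ`). -/
theorem joint_diagonalizer_gives_local_pieces_of_ism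
    {N M K : ℕ} (A : Matrix (Fin N) (Fin N) ℝ)
    (hA : A.PosSemidef) (hrank : A.rank = K)
    (P : Fin M → Finset (Fin N)) (hP : IsPartition P)
    (hreg : RegularSparse K A P)
    (Km : Fin M → ℕ) (hKm : ∀ m, Km m = patchRank A (P m))
    (H : ∀ m, Matrix ↥(P m) (Fin (Km m)) ℝ)
    (hHli : ∀ m, LinearIndependent ℝ (fun j : Fin (Km m) => fun i : ↥(P m) => H m i j))
    (hH : ∀ m, A.submatrix (fun i : ↥(P m) => (i : Fin N)) (fun i : ↥(P m) => (i : Fin N))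
      = H m * (H m)ᵀ)
    (Λ : Matrix ((m : Fin M) × Fin (Km m)) ((m : Fin M) × Fin (Km m)) ℝ)
    (hΛ : A = Hext P Km H * Λ * (Hext P Km H)ᵀ)
    (m : Fin M)
    (Dm : Matrix (Fin (Km m)) (Fin (Km m)) ℝ)
    (hDorth : Dmᵀ * Dm = 1 ∧ Dm * Dmᵀ = 1)
    (hmin : ∀ V : Matrix (Fin (Km m)) (Fin (Km m)) ℝ, Vᵀ * V = 1 → V * Vᵀ = 1 →
      offDiagObj (fun n => ΛBlock Λ m n * (ΛBlock Λ m n)ᵀ) Dm ≤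
        offDiagObj (fun n => ΛBlock Λ m n * (ΛBlock Λ m n)ᵀ) V) :
    ∃ φ : Fin K → Fin N → ℝ, IsISM A P φ ∧
      ∃ eφ : Fin (Km m) ≃ {k : Fin K // restrictPatch (P m) (φ k) ≠ 0},
        ∀ (j : Fin (Km m)) (i : ↥(P m)), (H m * Dm) i j = φ (eφ j : Fin K) (i : Fin N) := by
  classical
  obtain ⟨g, hg, hgli⟩ := hreg
  choose L hL using fun n => exists_mul_eq_one_of_linearIndependent_cols (H n) (hHli n)
  have hBB : ∀ {ψ : Fin K → Fin N → ℝ}, A = ∑ k, vecMulVec (ψ k) (ψ k) → ∀ n,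
      localPieces (P n) ψ * (localPieces (P n) ψ)ᵀ = H n * (H n)ᵀ := fun hψ n => by
    rw [← submatrix_eq_localPieces_mul hψ, hH]
  have hzero : ∀ {ψ : Fin K → Fin N → ℝ} (n k), ¬ restrictPatch (P n) (ψ k) ≠ 0 →
      ∀ i, localPieces (P n) ψ i k = 0 := fun n k hk i => congrFun (not_not.1 hk) i
  have hlower : ∀ ψ : Fin K → Fin N → ℝ, A = ∑ k, vecMulVec (ψ k) (ψ k) → ∀ n,
      Km n ≤ (Finset.univ.filter fun k => restrictPatch (P n) (ψ k) ≠ 0).card := by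
    intro ψ hψ n
    have h := card_le_card_of_mul_transpose_eq_one
      (leftInverse_mul_mul_transpose_eq_one (hL n) (hBB hψ n))
      (Finset.univ.filter fun k => restrictPatch (P n) (ψ k) ≠ 0) (fun k hk i => by
        rw [Matrix.mul_apply]
        refine Finset.sum_eq_zero fun j _ => ?_
        rw [hzero n k (by simpa using hk) j, mul_zero])
    simpa using h
  set p : Fin M → Fin K → Prop := fun n k => restrictPatch (P n) (g k) ≠ 0
  obtain ⟨D, hDdef⟩ : ∃ D : ∀ n, Matrix (Fin (Km n)) (Fin K) ℝ,
      ∀ n, D n = L n * localPieces (P n) g := ⟨_, fun _ => rfl⟩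
  have hHD : ∀ n, H n * D n = localPieces (P n) g := fun n => by
    rw [hDdef]; exact mul_leftInverse_mul_eq (hL n) (hBB hg n)
  have hDD : ∀ n, D n * (D n)ᵀ = 1 := fun n => by
    rw [hDdef]; exact leftInverse_mul_mul_transpose_eq_one (hL n) (hBB hg n)
  obtain ⟨E, hEdef⟩ : ∃ E : Fin M → Matrix (Fin K) (Fin K) ℝ,
      ∀ n, E n = Matrix.diagonal fun k => if p n k then 1 else 0 := ⟨_, fun _ => rfl⟩
  have hE : ∀ n, (D n)ᵀ * D n = E n := fun n => by
    rw [hEdef]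
    exact transpose_mul_self_eq_diagonal (hHD n) (hDdef n).symm (hDD n) (p n) (hzero n) (hgli n)
  have hcard : ∀ n, Km n = (Finset.univ.filter (p n)).card := by
    intro n
    have h := Matrix.trace_mul_comm (D n) (D n)ᵀ
    rw [hDD, hE, Matrix.trace_one, hEdef, Matrix.trace_diagonal, Finset.sum_boole] at h
    simpa using h
  have hΛD : ∀ n, ΛBlock Λ m n = D m * (D n)ᵀ := by
    intro n
    have h := (submatrix_eq_mul_ΛBlock_mul hP hΛ m n).symm.trans
      (submatrix_eq_localPieces_mul hg _ _)
    calc ΛBlock Λ m n = (L m * H m) * ΛBlock Λ m n * (L n * H n)ᵀ := by simp [hL]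
      _ = L m * (H m * ΛBlock Λ m n * (H n)ᵀ) * (L n)ᵀ := by
        simp only [Matrix.transpose_mul, Matrix.mul_assoc]
      _ = D m * (D n)ᵀ := by
        rw [h]; simp only [hDdef, Matrix.transpose_mul, Matrix.mul_assoc]
  have hS : ∀ n, ΛBlock Λ m n * (ΛBlock Λ m n)ᵀ = D m * E n * (D m)ᵀ := by
    intro n
    rw [hΛD, ← hE]
    simp only [Matrix.transpose_mul, Matrix.transpose_transpose, Matrix.mul_assoc]
  simp only [hS] at hmin
  have hcard' : Fintype.card (Fin (Km m)) = Fintype.card {k // p m k} := by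
    rw [Fintype.card_fin, Fintype.card_subtype, hcard]
  let e : Fin (Km m) ≃ {k // p m k} := Fintype.equivOfCardEq hcard'
  -- the square orthogonal matrix formed by the nonzero columns of `D m`
  set V : Matrix (Fin (Km m)) (Fin (Km m)) ℝ := (D m).submatrix id fun j => (e j : Fin K)
  have hVV : Vᵀ * V = 1 := by
    ext i j
    have : (Vᵀ * V) i j = ((D m)ᵀ * D m) (e i) (e j) := rfl
    rw [this, hE, hEdef, Matrix.diagonal_apply, Matrix.one_apply, if_pos (e i).2]
    simp [Subtype.coe_inj]
  have hVV' : V * Vᵀ = 1 := mul_eq_one_comm.1 hVV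
  have hobj : offDiagObj (fun n => D m * E n * (D m)ᵀ) V = 0 := by
    refine Finset.sum_eq_zero fun n _ => Finset.sum_eq_zero fun i _ =>
      Finset.sum_eq_zero fun j _ => ?_
    split_ifs with hij
    · have h : (Vᵀ * (D m * E n * (D m)ᵀ) * V) i j =
          (((D m)ᵀ * (D m * E n * (D m)ᵀ)) * D m) (e i) (e j) := rfl
      have h' : ((D m)ᵀ * (D m * E n * (D m)ᵀ)) * D m = E m * E n * E m := by
        rw [← hE m]; simp only [Matrix.mul_assoc]
      have hne : (e i : Fin K) ≠ e j := fun h => hij (e.injective (Subtype.ext h))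
      rw [h, h']
      simp only [hEdef, Matrix.diagonal_mul_diagonal]
      rw [Matrix.diagonal_apply_ne _ hne]
      simp
    · rfl
  have hoff := fun n => @apply_eq_zero_of_offDiagObj_le_zero _ _ _ _
    ((hmin V hVV hVV').trans_eq hobj) n
  obtain ⟨U, hU⟩ : ∃ U : Matrix (Fin K) (Fin (Km m)) ℝ, U = (D m)ᵀ * Dm := ⟨_, rfl⟩
  have hUU : U * Uᵀ = E m := by
    rw [hU, Matrix.transpose_mul, Matrix.mul_assoc, ← Matrix.mul_assoc Dm, hDorth.2,
      Matrix.one_mul, Matrix.transpose_transpose, hE]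
  have hEU : E m * U = U := by
    rw [hU, ← hE, Matrix.mul_assoc, ← Matrix.mul_assoc (D m), hDD, Matrix.one_mul]
  have hBU : localPieces (P m) g * U = H m * Dm := by
    rw [← hHD, hU, Matrix.mul_assoc, ← Matrix.mul_assoc (D m), hDD, Matrix.one_mul]
  -- each column of `U` is a common eigenvector of all the `E n`
  have heig : ∀ n k j, U k j ≠ 0 → (if p n k then (1 : ℝ) else 0) = (Uᵀ * E n * U) j j := by
    intro n k j hkj
    have h1 : E n * U = U * (Uᵀ * E n * U) := by
      have hcomm : E m * E n = E n * E m := by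
        simp only [hEdef, Matrix.diagonal_mul_diagonal, mul_comm]
      rw [← Matrix.mul_assoc, ← Matrix.mul_assoc, hUU, hcomm, Matrix.mul_assoc, hEU]
    have h2 := congrFun (congrFun h1 k) j
    nth_rewrite 1 [hEdef] at h2
    rw [Matrix.diagonal_mul, Matrix.mul_apply, Finset.sum_eq_single j] at h2
    · rw [mul_comm] at h2
      exact mul_left_cancel₀ hkj h2
    · intro i _ hij
      have h3 : Uᵀ * E n * U = Dmᵀ * (D m * E n * (D m)ᵀ) * Dm := by
        simp only [hU, Matrix.transpose_mul, Matrix.transpose_transpose, Matrix.mul_assoc]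
      have h4 := hoff n hij
      rw [← h3] at h4
      exact mul_eq_zero_of_right _ h4
    · simp
  have hdet : (Vᵀ * Dm).det ≠ 0 := by
    have h : (Vᵀ * Dm) * (Dmᵀ * V) = 1 := by
      rw [Matrix.mul_assoc, ← Matrix.mul_assoc Dm, hDorth.2, Matrix.one_mul, hVV]
    intro h0
    have := congrArg Matrix.det h
    rw [Matrix.det_mul, h0] at this
    simp at this
  obtain ⟨σ, hσ⟩ := exists_perm_forall_ne_zero hdet
  let f : Fin (Km m) ≃ {k // p m k} := σ.trans e
  have hf : ∀ j, U (f j) j ≠ 0 := by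
    rw [hU]
    exact hσ
  let φ : Fin K → Fin N → ℝ := fun k =>
    if h : p m k then ∑ k', U k' (f.symm ⟨k, h⟩) • g k' else g k
  have hφf : ∀ j, φ (f j) = ∑ k', U k' j • g k' := by
    intro j
    simp only [φ]
    rw [dif_pos (f j).2]
    simp
  have hφn : ∀ k, ¬ p m k → φ k = g k := fun k hk => dif_neg hk
  have hφm : ∀ j (i : ↥(P m)), φ (f j) (i : Fin N) = (H m * Dm) i j := by
    intro j i
    rw [hφf, ← hBU, Matrix.mul_apply]
    simp [localPieces, mul_comm]
  have hφA : A = ∑ k, vecMulVec (φ k) (φ k) := by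
    ext a b
    rw [hg]
    simp only [Matrix.sum_apply, Matrix.vecMulVec_apply]
    rw [← Fintype.sum_subtype_add_sum_subtype (p m),
      ← Fintype.sum_subtype_add_sum_subtype (p m) fun k => φ k a * φ k b]
    congr 1
    · rw [← Equiv.sum_comp f fun k => φ k a * φ k b]
      let X : Matrix Unit (Fin K) ℝ := Matrix.of fun _ k => g k a
      let Y : Matrix Unit (Fin K) ℝ := Matrix.of fun _ k => g k b
      have h1 : ∑ j, φ (f j) a * φ (f j) b = ((X * U) * (Y * U)ᵀ) () () := by
        rw [Matrix.mul_apply]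
        refine Finset.sum_congr rfl fun j _ => ?_
        simp [hφf, X, Y, Matrix.mul_apply, mul_comm]
      have h2 : (X * U) * (Y * U)ᵀ = X * E m * Yᵀ := by
        rw [← hUU]; simp only [Matrix.transpose_mul, Matrix.mul_assoc]
      rw [h1, h2, Matrix.mul_apply]
      simp only [hEdef, Matrix.mul_diagonal]
      rw [← Fintype.sum_subtype_add_sum_subtype (p m), Finset.sum_eq_zero (s :=
        (Finset.univ : Finset {k // ¬ p m k})) (fun k _ => by rw [if_neg k.2]; simp), add_zero]
      refine Finset.sum_congr rfl fun k _ => ?_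
      rw [if_pos k.2]
      simp [X, Y]
    · exact Finset.sum_congr rfl fun k _ => by rw [hφn k k.2]
  have hsub : ∀ n k, restrictPatch (P n) (φ k) ≠ 0 → p n k := by
    intro n k hk
    by_cases hkm : p m k
    · obtain ⟨j, hj⟩ := f.surjective ⟨k, hkm⟩
      have hk' : k = f j := by rw [hj]
      subst hk'
      refine by_contra fun hnk => hk (funext fun i => ?_)
      simp only [restrictPatch, hφf, Finset.sum_apply, Pi.smul_apply, smul_eq_mul, Pi.zero_apply]
      refine Finset.sum_eq_zero fun k' _ => ?_
      by_cases hU0 : U k' j = 0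
      · rw [hU0, zero_mul]
      · have h := (heig n k' j hU0).trans (heig n _ j (hf j)).symm
        rw [if_neg hnk] at h
        have hk'n : ¬ p n k' := fun h' => by rw [if_pos h'] at h; exact one_ne_zero h
        exact mul_eq_zero_of_right _ (hzero n k' hk'n i)
    · rwa [hφn k hkm] at hk
  have hiff : ∀ k, p m k ↔ restrictPatch (P m) (φ k) ≠ 0 := by
    refine fun k => ⟨fun hk h0 => ?_, hsub m k⟩
    obtain ⟨j, hj⟩ := f.surjective ⟨k, hk⟩
    have hk' : k = f j := by rw [hj]
    subst hk'
    have h1 : (Dmᵀ * (L m * (H m * Dm))) j j = 1 := by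
      rw [← Matrix.mul_assoc (L m), hL, Matrix.one_mul, hDorth.1, Matrix.one_apply_eq]
    have h2 : ∀ i, (H m * Dm) i j = 0 := fun i => (hφm j i).symm.trans (congrFun h0 i)
    rw [← Matrix.mul_assoc, Matrix.mul_apply] at h1
    simp [h2] at h1
  refine ⟨φ, ⟨hφA, fun ψ hψ => ?_⟩, f.trans (Equiv.subtypeEquivRight hiff), fun j i => ?_⟩
  · rw [sum_sparseness_eq, sum_sparseness_eq]
    refine Finset.sum_le_sum fun n _ => le_trans ?_ ((hcard n).ge.trans (hlower ψ hψ n))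
    exact Finset.card_le_card fun k hk => by
      simp only [Finset.mem_filter, Finset.mem_univ, true_and] at hk ⊢
      exact hsub n k hk
  · exact (hφm j i).symm
end
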